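/- Let α, β ∈ S_n and suppose the commutator [α,β] = α⁻¹β⁻¹αβ fixes at least n−4 points. Then there exists a permutation γ ∈ S_n such that γ⁻¹αγ = α⁻¹ and γ⁻¹βγ = β⁻¹. -/

import Mathlib

namespace Neftin

/-! ## The finite combinatorial part -/

/-- `j` lies on the `q`-cycle of `i` (for at most four points). -/
def rel {m : ℕ} (q : Fin m → Fin m) (i j : Fin m) : Prop :=
  i = j ∨ q i = j ∨ q (q i) = j ∨ q (q (q i)) = j

instance {m : ℕ} (q : Fin m → Fin m) (i j : Fin m) : Decidable (rel q i j) := by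
  unfold rel; infer_instance

def Strict {m : ℕ} (P Q : Fin m → Prop) : Prop :=
  (∀ j, P j → Q j) ∧ ∃ j, Q j ∧ ¬ P j

def Exch {m : ℕ} (P Q : Fin m → Prop) (a b : Fin m) : Prop :=
  P a ∧ ¬ Q a ∧ ¬ P b ∧ Q b ∧ ∀ l, l ≠ a → l ≠ b → (P l ↔ Q l)

instance {m : ℕ} (P Q : Fin m → Prop) [DecidablePred P] [DecidablePred Q] :
    Decidable (Strict P Q) := by unfold Strict; infer_instance

instance {m : ℕ} (P Q : Fin m → Prop) [DecidablePred P] [DecidablePred Q] (a b : Fin m) :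
    Decidable (Exch P Q a b) := by unfold Exch; infer_instance

/-- Impossible length relations. -/
def AltA {m : ℕ} (q q' mu : Fin m → Fin m) : Prop :=
  ∃ i, Strict (rel q i) (rel q' (mu i)) ∨ Strict (rel q' (mu i)) (rel q i)

/-- The arc involution exists and its length equalities are forced. -/
def AltB {m : ℕ} (c q q' mu rho : Fin m → Fin m) : Prop :=
  (∀ i, rho (rho i) = i) ∧ (∀ i, c (rho i) = q (rho (q i))) ∧
    (∀ i, rel q' (mu i) (rho i)) ∧
    ∀ i, rho i = i ∨ ∃ j, Exch (rel q j) (rel q' (mu j)) i (rho i) ∨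
      Exch (rel q j) (rel q' (mu j)) (rho i) i

instance {m : ℕ} (q q' mu : Fin m → Fin m) : Decidable (AltA q q' mu) := by
  unfold AltA; infer_instance

instance {m : ℕ} (c q q' mu rho : Fin m → Fin m) : Decidable (AltB c q q' mu rho) := by
  unfold AltB; infer_instance

def Same {m : ℕ} (q q' : Fin m → Fin m) (i j a b : Fin m) : Prop := rel q i j ↔ rel q' a b

instance {m : ℕ} (q q' : Fin m → Fin m) (i j a b : Fin m) : Decidable (Same q q' i j a b) := by
  unfold Same; infer_instance

def Canon {m : ℕ} (q : Fin m → Fin m) (i : Fin m) : Prop := ∀ j, rel q i j → i ≤ j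

instance {m : ℕ} (q : Fin m → Fin m) (i : Fin m) : Decidable (Canon q i) := by
  unfold Canon; infer_instance

def invs4 : List (Fin 4 → Fin 4) :=
  [![0,1,2,3], ![1,0,2,3], ![2,1,0,3], ![3,1,2,0], ![0,2,1,3], ![0,3,2,1], ![0,1,3,2],
    ![1,0,3,2], ![2,3,0,1], ![3,2,1,0]]

def Concl4 (c q q' mu : Fin 4 → Fin 4) : Prop :=
  (∀ j, ∃ i, rel q' (mu i) j) → AltA q q' mu ∨ ∃ rho ∈ invs4, AltB c q q' mu rho

instance (c q q' mu : Fin 4 → Fin 4) : Decidable (Concl4 c q q' mu) := by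
  unfold Concl4; infer_instance

def Inner4 (c q q' : Fin 4 → Fin 4) : Prop :=
  ∀ m0, Canon q' m0 → ∀ m1, Canon q' m1 ∧ Same q q' 0 1 m0 m1 →
    ∀ m2, Canon q' m2 ∧ Same q q' 0 2 m0 m2 ∧ Same q q' 1 2 m1 m2 →
    ∀ m3, Canon q' m3 ∧ Same q q' 0 3 m0 m3 ∧ Same q q' 1 3 m1 m3 ∧ Same q q' 2 3 m2 m3 →
      Concl4 c q q' ![m0, m1, m2, m3]

instance (c q q' : Fin 4 → Fin 4) : Decidable (Inner4 c q q') := by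
  unfold Inner4; infer_instance

def Outer4 (c : Fin 4 → Fin 4) : Prop :=
  ∀ q0 q1 : Fin 4, q0 ≠ q1 → ∀ q2, q0 ≠ q2 ∧ q1 ≠ q2 → ∀ q3, q0 ≠ q3 ∧ q1 ≠ q3 ∧ q2 ≠ q3 →
    Inner4 c ![q0, q1, q2, q3] ![c q0, c q1, c q2, c q3]

instance (c : Fin 4 → Fin 4) : Decidable (Outer4 c) := by
  unfold Outer4; infer_instance

theorem comb4a : Outer4 ![1,0,3,2] := by decide +kernel
theorem comb4b : Outer4 ![2,3,0,1] := by decide +kernel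
theorem comb4c : Outer4 ![3,2,1,0] := by decide +kernel

def invs3 : List (Fin 3 → Fin 3) :=
  [![0,1,2], ![1,0,2], ![2,1,0], ![0,2,1]]

def Concl3 (c q q' mu : Fin 3 → Fin 3) : Prop :=
  (∀ j, ∃ i, rel q' (mu i) j) → AltA q q' mu ∨ ∃ rho ∈ invs3, AltB c q q' mu rho

instance (c q q' mu : Fin 3 → Fin 3) : Decidable (Concl3 c q q' mu) := by
  unfold Concl3; infer_instance

def Inner3 (c q q' : Fin 3 → Fin 3) : Prop :=
  ∀ m0 m1 : Fin 3, Same q q' 0 1 m0 m1 → ∀ m2, Same q q' 0 2 m0 m2 ∧ Same q q' 1 2 m1 m2 →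
      Concl3 c q q' ![m0, m1, m2]

instance (c q q' : Fin 3 → Fin 3) : Decidable (Inner3 c q q') := by
  unfold Inner3; infer_instance

def Outer3 (c d : Fin 3 → Fin 3) : Prop :=
  ∀ q0 q1 : Fin 3, q0 ≠ q1 → ∀ q2, q0 ≠ q2 ∧ q1 ≠ q2 →
    Inner3 c ![q0, q1, q2] ![d q0, d q1, d q2]

instance (c d : Fin 3 → Fin 3) : Decidable (Outer3 c d) := by
  unfold Outer3; infer_instance

theorem comb3a : Outer3 ![1,2,0] ![2,0,1] := by decide +kernel
theorem comb3b : Outer3 ![2,0,1] ![1,2,0] := by decide +kernel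

/-- The full finite statement, lengths included. -/
def Good (m : ℕ) (c d : Fin m → Fin m) : Prop :=
  ∀ (q mu : Fin m → Fin m) (len : Fin m → ℕ), Function.Injective q → (∀ i, 0 < len i) →
    (∀ i, Canon (fun k => d (q k)) (mu i)) →
    (∀ i j, Same q (fun k => d (q k)) i j (mu i) (mu j)) →
    (∀ j, ∃ i, rel (fun k => d (q k)) (mu i) j) →
    (∀ i, ∑ j with rel q i j, len j = ∑ j with rel (fun k => d (q k)) (mu i) j, len j) →
    ∃ rho : Fin m → Fin m, (∀ i, rho (rho i) = i) ∧ (∀ i, c (rho i) = q (rho (q i))) ∧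
      (∀ i, len (rho i) = len i) ∧ ∀ i, rel (fun k => d (q k)) (mu i) (rho i)

theorem strict_sum {m : ℕ} (P Q : Fin m → Prop) [DecidablePred P] [DecidablePred Q]
    (len : Fin m → ℕ) (hpos : ∀ i, 0 < len i) (h : Strict P Q) :
    ∑ j with P j, len j < ∑ j with Q j, len j := by
  obtain ⟨h1, j, hj, hj'⟩ := h
  apply Finset.sum_lt_sum_of_subset (i := j)
  · intro x; simpa using h1 x
  · simpa using hj
  · simpa using hj'
  · exact hpos j
  · intros; exact Nat.zero_le _

theorem exch_sum {m : ℕ} (P Q : Fin m → Prop) [DecidablePred P] [DecidablePred Q]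
    (len : Fin m → ℕ) (a b : Fin m) (h : Exch P Q a b)
    (hs : ∑ j with P j, len j = ∑ j with Q j, len j) : len a = len b := by
  obtain ⟨h1, h2, h3, h4, h5⟩ := h
  have e1 := Finset.add_sum_erase (Finset.univ.filter P) len (a := a) (by simpa using h1)
  have e2 := Finset.add_sum_erase (Finset.univ.filter Q) len (a := b) (by simpa using h4)
  have e3 : (Finset.univ.filter P).erase a = (Finset.univ.filter Q).erase b := by
    ext x
    simp only [Finset.mem_erase, Finset.mem_filter, Finset.mem_univ, true_and]
    by_cases ha : x = a
    · subst ha; tauto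
    by_cases hb : x = b
    · subst hb; tauto
    have := h5 x ha hb
    tauto
  have hs' : (Finset.univ.filter P).sum len = (Finset.univ.filter Q).sum len := hs
  rw [e3] at e1
  rw [← e1, ← e2] at hs'
  omega

theorem good_finish {m : ℕ} (c q q' mu : Fin m → Fin m) (len : Fin m → ℕ)
    (hpos : ∀ i, 0 < len i)
    (hs : ∀ i, ∑ j with rel q i j, len j = ∑ j with rel q' (mu i) j, len j)
    (h : AltA q q' mu ∨ ∃ rho, AltB c q q' mu rho) :
    ∃ rho : Fin m → Fin m, (∀ i, rho (rho i) = i) ∧ (∀ i, c (rho i) = q (rho (q i))) ∧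
      (∀ i, len (rho i) = len i) ∧ ∀ i, rel q' (mu i) (rho i) := by
  rcases h with ⟨i, h | h⟩ | ⟨rho, h1, h2, h3, h4⟩
  · have := strict_sum _ _ len hpos h
    have := hs i
    omega
  · have := strict_sum _ _ len hpos h
    have := hs i
    omega
  · refine ⟨rho, h1, h2, fun i => ?_, h3⟩
    rcases h4 i with h | ⟨j, h | h⟩
    · rw [h]
    · exact (exch_sum _ _ len _ _ h (hs j)).symm
    · exact exch_sum _ _ len _ _ h (hs j)

theorem vec4 (f : Fin 4 → Fin 4) : f = ![f 0, f 1, f 2, f 3] := by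
  ext i; fin_cases i <;> rfl

theorem vec3 (f : Fin 3 → Fin 3) : f = ![f 0, f 1, f 2] := by
  ext i; fin_cases i <;> rfl

theorem good4 (c : Fin 4 → Fin 4) (h : Outer4 c) : Good 4 c c := by
  intro q mu len hq hpos hcan hsame hsurj hsum
  have hne : ∀ i j : Fin 4, i ≠ j → q i ≠ q j := fun i j hij h => hij (hq h)
  have e1 : (fun k => c (q k)) = ![c (q 0), c (q 1), c (q 2), c (q 3)] := vec4 _
  have hi := h (q 0) (q 1) (hne _ _ (by decide)) (q 2)
    ⟨hne _ _ (by decide), hne _ _ (by decide)⟩ (q 3)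
    ⟨hne _ _ (by decide), hne _ _ (by decide), hne _ _ (by decide)⟩
  rw [← e1, ← vec4 q] at hi
  have hc := hi (mu 0) (hcan 0) (mu 1) ⟨hcan 1, hsame 0 1⟩ (mu 2)
    ⟨hcan 2, hsame 0 2, hsame 1 2⟩ (mu 3) ⟨hcan 3, hsame 0 3, hsame 1 3, hsame 2 3⟩
  rw [← vec4 mu] at hc
  apply good_finish c q _ mu len hpos hsum
  rcases hc hsurj with h | ⟨rho, _, h⟩
  · exact Or.inl h
  · exact Or.inr ⟨rho, h⟩

theorem good3 (c d : Fin 3 → Fin 3) (h : Outer3 c d) : Good 3 c d := by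
  intro q mu len hq hpos hcan hsame hsurj hsum
  have hne : ∀ i j : Fin 3, i ≠ j → q i ≠ q j := fun i j hij h => hij (hq h)
  have e1 : (fun k => d (q k)) = ![d (q 0), d (q 1), d (q 2)] := vec3 _
  have hi := h (q 0) (q 1) (hne _ _ (by decide)) (q 2)
    ⟨hne _ _ (by decide), hne _ _ (by decide)⟩
  rw [← e1, ← vec3 q] at hi
  have hc := hi (mu 0) (mu 1) (hsame 0 1) (mu 2) ⟨hsame 0 2, hsame 1 2⟩
  rw [← vec3 mu] at hc
  apply good_finish c q _ mu len hpos hsum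
  rcases hc hsurj with h | ⟨rho, _, h⟩
  · exact Or.inl h
  · exact Or.inr ⟨rho, h⟩

theorem derange4 : ∀ c : Equiv.Perm (Fin 4), (∀ i, c i ≠ i) → Equiv.Perm.sign c = 1 →
    (∀ i, c i = ![1,0,3,2] i ∧ c.symm i = ![1,0,3,2] i) ∨
    (∀ i, c i = ![2,3,0,1] i ∧ c.symm i = ![2,3,0,1] i) ∨
    (∀ i, c i = ![3,2,1,0] i ∧ c.symm i = ![3,2,1,0] i) := by decide +kernel

theorem derange3 : ∀ c : Equiv.Perm (Fin 3), (∀ i, c i ≠ i) →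
    (∀ i, c i = ![1,2,0] i ∧ c.symm i = ![2,0,1] i) ∨
    (∀ i, c i = ![2,0,1] i ∧ c.symm i = ![1,2,0] i) := by decide +kernel

theorem derange2 : ∀ c : Equiv.Perm (Fin 2), (∀ i, c i ≠ i) → Equiv.Perm.sign c ≠ 1 := by
  decide +kernel

theorem good_all (m : ℕ) (hm : m ≤ 4) (c : Equiv.Perm (Fin m)) (hc : ∀ i, c i ≠ i)
    (hs : Equiv.Perm.sign c = 1) : Good m c c.symm := by
  interval_cases m
  · intro q mu len _ _ _ _ _ _
    exact ⟨id, fun i => i.elim0, fun i => i.elim0, fun i => i.elim0, fun i => i.elim0⟩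
  · exact absurd (Subsingleton.elim _ _) (hc 0)
  · exact absurd hs (derange2 c hc)
  · rcases derange3 c hc with h | h
    · rw [funext fun i => (h i).1, funext fun i => (h i).2]; exact good3 _ _ comb3a
    · rw [funext fun i => (h i).1, funext fun i => (h i).2]; exact good3 _ _ comb3b
  · rcases derange4 c hc hs with h | h | h
    · rw [funext fun i => (h i).1, funext fun i => (h i).2]; exact good4 _ comb4a
    · rw [funext fun i => (h i).1, funext fun i => (h i).2]; exact good4 _ comb4b
    · rw [funext fun i => (h i).1, funext fun i => (h i).2]; exact good4 _ comb4c

theorem rel_of_iterate {m : ℕ} (hm : m ≤ 4) (q : Fin m → Fin m) (hq : Function.Injective q)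
    (i : Fin m) (n : ℕ) : rel q i (q^[n] i) := by
  have key : rel q i (q (q (q (q i)))) := by
    by_contra hcon
    simp only [rel, not_or] at hcon
    obtain ⟨h0, h1, h2, h3⟩ := hcon
    have a1 : q i ≠ i := fun h => by simp [h] at h0
    have a2 : q (q i) ≠ i := fun h => by simp [h] at h0
    have a3 : q (q (q i)) ≠ i := fun h => h1 (by rw [h])
    have b2 : q (q i) ≠ q i := fun h => a1 (hq h)
    have b3 : q (q (q i)) ≠ q i := fun h => a2 (hq h)
    have c3 : q (q (q i)) ≠ q (q i) := fun h => b2 (hq h)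
    have : ({i, q i, q (q i), q (q (q i)), q (q (q (q i)))} : Finset (Fin m)).card = 5 := by
      rw [Finset.card_insert_of_notMem, Finset.card_insert_of_notMem,
        Finset.card_insert_of_notMem, Finset.card_insert_of_notMem, Finset.card_singleton]
      all_goals simp only [Finset.mem_insert, Finset.mem_singleton, not_or]
      · exact h3
      · exact ⟨c3.symm, h2⟩
      · exact ⟨b2.symm, b3.symm, h1⟩
      · exact ⟨a1.symm, a2.symm, a3.symm, h0⟩
    have h5 := Finset.card_le_univ ({i, q i, q (q i), q (q (q i)), q (q (q (q i)))} : Finset (Fin m))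
    rw [this, Fintype.card_fin] at h5
    omega
  induction n with
  | zero => left; rfl
  | succ n ih =>
    rw [Function.iterate_succ_apply']
    rcases ih with h | h | h | h
    · rw [← h]; right; left; rfl
    · rw [← h]; right; right; left; rfl
    · rw [← h]; right; right; right; rfl
    · rw [← h]; exact key

theorem iterate_of_rel {m : ℕ} (q : Fin m → Fin m) (i j : Fin m) (h : rel q i j) :
    ∃ n, q^[n] i = j := by
  rcases h with h | h | h | h
  · exact ⟨0, h⟩
  · exact ⟨1, h⟩
  · exact ⟨2, h⟩
  · exact ⟨3, h⟩

/-! ## Arcs: first return to a subset -/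

structure Arc {Ω ι : Type*} (b : Equiv.Perm Ω) (s : ι → Ω) (len : ι → ℕ) (q : ι → ι) : Prop where
  inj : Function.Injective s
  pos : ∀ i, 0 < len i
  off : ∀ i p, 0 < p → p < len i → ∀ j, (b ^ p) (s i) ≠ s j
  ret : ∀ i, (b ^ len i) (s i) = s (q i)

section
variable {Ω ι : Type*} {b : Equiv.Perm Ω} {s : ι → Ω} {len : ι → ℕ} {q : ι → ι}

theorem Arc.exists [Finite Ω] (b : Equiv.Perm Ω) (s : ι → Ω) (hs : Function.Injective s) :
    ∃ len q, Arc b s len q := by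
  classical
  have hex : ∀ i, ∃ p, 0 < p ∧ ∃ j, (b ^ p) (s i) = s j := fun i =>
    ⟨orderOf b, orderOf_pos b, i, by rw [pow_orderOf_eq_one]; rfl⟩
  have hj : ∀ i, ∃ j, (b ^ (Nat.find (hex i))) (s i) = s j := fun i => (Nat.find_spec (hex i)).2
  choose q hq using hj
  exact ⟨fun i => Nat.find (hex i), q, hs, fun i => (Nat.find_spec (hex i)).1,
    fun i p hp hlt j h => Nat.find_min (hex i) hlt ⟨hp, j, h⟩, hq⟩

theorem pow_sub_cancel (b : Equiv.Perm Ω) {t t' : ℕ} (h : t ≤ t') {x y : Ω}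
    (e : (b ^ t) x = (b ^ t') y) : x = (b ^ (t' - t)) y := by
  apply (b ^ t).injective
  rw [e, ← Equiv.Perm.mul_apply, ← pow_add]
  congr 2; omega

theorem Arc.uniq (A : Arc b s len q) {i j : ι} {t t' : ℕ} (h : t < len i) (h' : t' < len j)
    (e : (b ^ t) (s i) = (b ^ t') (s j)) : i = j ∧ t = t' := by
  rcases lt_trichotomy t t' with hlt | heq | hlt
  · exact absurd (pow_sub_cancel b hlt.le e).symm (A.off j (t' - t) (by omega) (by omega) i)
  · subst heq
    exact ⟨A.inj ((b ^ t).injective e), rfl⟩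
  · exact absurd (pow_sub_cancel b hlt.le e.symm).symm (A.off i (t - t') (by omega) (by omega) j)

theorem Arc.len_eq (A : Arc b s len q) {i j : ι} {n : ℕ} (hn : 0 < n)
    (h : ∀ p, 0 < p → p < n → ∀ j, (b ^ p) (s i) ≠ s j) (e : (b ^ n) (s i) = s j) :
    len i = n ∧ q i = j := by
  have : len i = n := by
    rcases lt_trichotomy (len i) n with hlt | heq | hlt
    · exact absurd (A.ret i) (h _ (A.pos i) hlt _)
    · exact heq
    · exact absurd e (A.off i n hn hlt j)
  refine ⟨this, A.inj ?_⟩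
  rw [← A.ret, this, e]

theorem Arc.qinj (A : Arc b s len q) : Function.Injective q := by
  intro i j h
  have e : (b ^ len i) (s i) = (b ^ len j) (s j) := by rw [A.ret, A.ret, h]
  have hi := A.pos i
  have hj := A.pos j
  rcases lt_trichotomy (len i) (len j) with hlt | heq | hlt
  · exact absurd (pow_sub_cancel b hlt.le e).symm (A.off j _ (by omega) (by omega) i)
  · rw [heq] at e
    exact A.inj ((b ^ len j).injective e)
  · exact absurd (pow_sub_cancel b hlt.le e.symm).symm (A.off i _ (by omega) (by omega) j)

theorem Arc.iter (A : Arc b s len q) (i : ι) (n : ℕ) :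
    ∃ k t, t < len (q^[k] i) ∧ (b ^ n) (s i) = (b ^ t) (s (q^[k] i)) := by
  induction n with
  | zero => exact ⟨0, 0, A.pos _, rfl⟩
  | succ n ih =>
    obtain ⟨k, t, ht, e⟩ := ih
    rcases Nat.lt_or_ge (t + 1) (len (q^[k] i)) with h | h
    · refine ⟨k, t + 1, h, ?_⟩
      rw [pow_succ', pow_succ', Equiv.Perm.mul_apply, Equiv.Perm.mul_apply, e]
    · refine ⟨k + 1, 0, A.pos _, ?_⟩
      have : len (q^[k] i) = t + 1 := by omega
      rw [Function.iterate_succ_apply', ← A.ret, this, pow_succ', pow_succ',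
        Equiv.Perm.mul_apply, Equiv.Perm.mul_apply, e]
      rfl

theorem Arc.same (A : Arc b s len q) {i j : ι} {n : ℕ} (h : (b ^ n) (s i) = s j) :
    ∃ k, q^[k] i = j := by
  obtain ⟨k, t, ht, e⟩ := A.iter i n
  refine ⟨k, (A.uniq (t' := 0) ht (A.pos j) ?_).1⟩
  rw [← e, h]; rfl

theorem Arc.iterq (A : Arc b s len q) (i : ι) (k : ℕ) : ∃ n, (b ^ n) (s i) = s (q^[k] i) := by
  induction k with
  | zero => exact ⟨0, rfl⟩
  | succ k ih =>
    obtain ⟨n, e⟩ := ih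
    refine ⟨len (q^[k] i) + n, ?_⟩
    rw [pow_add, Equiv.Perm.mul_apply, e, A.ret, Function.iterate_succ_apply']

theorem sameCycle_nat [Finite Ω] {f : Equiv.Perm Ω} {x y : Ω} (h : f.SameCycle x y) :
    ∃ n : ℕ, (f ^ n) x = y := by
  obtain ⟨n, _, h⟩ := h.exists_pow_eq'
  exact ⟨n, h⟩

theorem sameCycle_of_nat {f : Equiv.Perm Ω} {x y : Ω} {n : ℕ} (h : (f ^ n) x = y) :
    f.SameCycle x y := ⟨n, by simpa using h⟩

theorem Arc.sameCycle_iff [Finite Ω] (A : Arc b s len q) (i j : ι) :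
    b.SameCycle (s i) (s j) ↔ ∃ k, q^[k] i = j := by
  constructor
  · intro h
    obtain ⟨n, h⟩ := sameCycle_nat h
    exact A.same h
  · rintro ⟨k, rfl⟩
    obtain ⟨n, h⟩ := A.iterq i k
    exact sameCycle_of_nat h

open Classical in
theorem Arc.card [Fintype Ω] [Fintype ι] (A : Arc b s len q) (i : ι) :
    (Finset.univ.filter fun y => b.SameCycle (s i) y).card =
      ∑ j with (∃ k, q^[k] i = j), len j := by
  have : (Finset.univ.filter fun y => b.SameCycle (s i) y) =
      ((Finset.univ.filter fun j => ∃ k, q^[k] i = j).sigma fun j => Finset.range (len j)).image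
        (fun x => (b ^ x.2) (s x.1)) := by
    ext y
    simp only [Finset.mem_filter, Finset.mem_univ, true_and, Finset.mem_image, Finset.mem_sigma,
      Finset.mem_range, Sigma.exists]
    constructor
    · intro h
      obtain ⟨n, rfl⟩ := sameCycle_nat h
      obtain ⟨k, t, ht, e⟩ := A.iter i n
      exact ⟨_, t, ⟨⟨k, rfl⟩, ht⟩, e.symm⟩
    · rintro ⟨j, t, ⟨⟨k, rfl⟩, ht⟩, rfl⟩
      obtain ⟨n, e⟩ := A.iterq i k
      rw [← e, ← Equiv.Perm.mul_apply, ← pow_add]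
      exact sameCycle_of_nat rfl
  rw [this, Finset.card_image_of_injOn, Finset.card_sigma]
  · simp
  · rintro ⟨j, t⟩ h ⟨j', t'⟩ h' e
    simp only [Finset.coe_sigma, Set.mem_sigma_iff, Finset.mem_coe, Finset.mem_range] at h h'
    obtain ⟨rfl, rfl⟩ := A.uniq h.2 h'.2 e
    rfl

/-- The flip of all arcs. -/
theorem Arc.flip (A : Arc b s len q) (rho : ι → ι) :
    ∃ r : Ω → Ω, ∀ i t, t < len i → r ((b ^ t) (s i)) = (b ^ (len i - 1 - t)) (s (rho i)) := by
  classical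
  refine ⟨fun y => if h : ∃ x : ι × ℕ, x.2 < len x.1 ∧ (b ^ x.2) (s x.1) = y then
    (b ^ (len h.choose.1 - 1 - h.choose.2)) (s (rho h.choose.1)) else y, fun i t ht => ?_⟩
  have h : ∃ x : ι × ℕ, x.2 < len x.1 ∧ (b ^ x.2) (s x.1) = (b ^ t) (s i) := ⟨(i, t), ht, rfl⟩
  simp only [dif_pos h]
  obtain ⟨e1, e2⟩ := A.uniq h.choose_spec.1 ht h.choose_spec.2
  rw [e1, e2]

theorem Arc.flip_flip {rho : ι → ι} {r : Ω → Ω}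
    (hr : ∀ i t, t < len i → r ((b ^ t) (s i)) = (b ^ (len i - 1 - t)) (s (rho i)))
    (h1 : ∀ i, rho (rho i) = i) (h2 : ∀ i, len (rho i) = len i) {i : ι} {t : ℕ} (ht : t < len i) :
    r (r ((b ^ t) (s i))) = (b ^ t) (s i) := by
  rw [hr i t ht, hr _ _ (by rw [h2]; omega), h1, h2]
  congr 2; omega

theorem Arc.flip_rel (A : Arc b s len q) {rho : ι → ι} {r : Ω → Ω}
    (hr : ∀ i t, t < len i → r ((b ^ t) (s i)) = (b ^ (len i - 1 - t)) (s (rho i)))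
    (h2 : ∀ i, len (rho i) = len i) (C : Equiv.Perm Ω) (hC : ∀ y, (∀ i, y ≠ s i) → C y = y)
    (hC' : ∀ i, C (s (rho i)) = s (q (rho (q i)))) {i : ι} {t : ℕ} (ht : t < len i) :
    b (r (b ((b ^ t) (s i)))) = C (r ((b ^ t) (s i))) := by
  rw [← Equiv.Perm.mul_apply b (b ^ t), ← pow_succ']
  rcases Nat.lt_or_ge (t + 1) (len i) with h | h
  · rw [hr i _ h, hr i _ ht, ← Equiv.Perm.mul_apply, ← pow_succ', hC]
    · congr 2; omega
    · exact A.off _ _ (by omega) (by rw [h2]; omega)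
  · have e : t + 1 = len i := by omega
    have e2 : s (q i) = (b ^ 0) (s (q i)) := rfl
    have e3 : len (q i) - 1 - 0 + 1 = len (rho (q i)) := by
      rw [h2]; have := A.pos (q i); omega
    have e4 : len i - 1 - t = 0 := by omega
    rw [hr i t ht, e, A.ret, e2, hr _ _ (A.pos _), ← Equiv.Perm.mul_apply, ← pow_succ', e3, A.ret,
      e4, pow_zero, Equiv.Perm.one_apply, hC']

end

/-! ## Commuting permutations -/

theorem comm_inv {Ω : Type*} (A B : Equiv.Perm Ω) (h : Commute A B) :
    ∃ g : Ω → Ω, (∀ y, g (g y) = y) ∧ (∀ y, g (A y) = A⁻¹ (g y)) ∧ ∀ y, g (B y) = B⁻¹ (g y) := by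
  let H := Subgroup.closure {A, B}
  have hA : A ∈ H := Subgroup.subset_closure (by simp)
  have hB : B ∈ H := Subgroup.subset_closure (by simp)
  have hcomm : ∀ u ∈ H, ∀ v ∈ H, u * v = v * u := by
    intro u hu v hv
    have : IsMulCommutative H := by
      apply Subgroup.isMulCommutative_closure
      rintro x (rfl | rfl) y (rfl | rfl)
      · rfl
      · exact h
      · exact h.symm
      · rfl
    exact congrArg Subtype.val (this.is_comm.comm (⟨u, hu⟩ : H) ⟨v, hv⟩)
  let S : Setoid Ω := MulAction.orbitRel H Ω
  let rep : Ω → Ω := fun y => Quotient.out (Quotient.mk S y)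
  have hrep : ∀ u ∈ H, ∀ y, rep (u y) = rep y := by
    intro u hu y
    have : (Quotient.mk S (u y)) = Quotient.mk S y := Quotient.sound ⟨⟨u, hu⟩, rfl⟩
    simp only [rep, this]
  have hex : ∀ y, ∃ u ∈ H, u (rep y) = y := by
    intro y
    obtain ⟨u, hu⟩ := S.symm (Quotient.mk_out (s := S) y)
    exact ⟨u, u.2, hu⟩
  choose w hw hwy using hex
  have key : ∀ y, ∀ u ∈ H, u (rep y) = y → (w y)⁻¹ (rep y) = u⁻¹ (rep y) := by
    intro y u hu e
    have h1 : (w y) (rep y) = u (rep y) := by rw [hwy, e]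
    rw [Equiv.Perm.inv_eq_iff_eq]
    have h2 : w y * u⁻¹ = u⁻¹ * w y := hcomm _ (hw y) _ (H.inv_mem hu)
    rw [← Equiv.Perm.mul_apply, h2, Equiv.Perm.mul_apply, h1]
    simp
  have stepu : ∀ u ∈ H, ∀ y, (w (u y))⁻¹ (rep (u y)) = u⁻¹ ((w y)⁻¹ (rep y)) := by
    intro u hu y
    rw [key (u y) (u * w y) (H.mul_mem hu (hw y)) (by
      rw [hrep u hu, Equiv.Perm.mul_apply, hwy]), hrep u hu, hcomm u hu _ (hw y), mul_inv_rev]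
    rfl
  refine ⟨fun y => (w y)⁻¹ (rep y), fun y => ?_, stepu A hA, stepu B hB⟩
  have hr : rep ((w y)⁻¹ (rep y)) = rep y := by
    rw [hrep _ (H.inv_mem (hw y))]
    conv_rhs => rw [← hwy y, hrep _ (hw y)]
  change (w ((w y)⁻¹ (rep y)))⁻¹ (rep ((w y)⁻¹ (rep y))) = y
  rw [key _ (w y)⁻¹ (H.inv_mem (hw y)) (by rw [hr]), hr, inv_inv, hwy]

theorem inv_self {Ω : Type*} (f : Equiv.Perm Ω) (x : Ω) : f⁻¹ (f x) = x := by simp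

theorem self_inv {Ω : Type*} (f : Equiv.Perm Ω) (x : Ω) : f (f⁻¹ x) = x := by simp

/-! ## The core construction -/

theorem core {Ω : Type*} [Fintype Ω] (α β c : Equiv.Perm Ω) (hcomm : α * β = β * (α * c))
    {m : ℕ} (hm : m ≤ 4) (s : Fin m → Ω) (hs : Function.Injective s) (cc dd : Fin m → Fin m)
    (hcs : ∀ i, c (s i) = s (cc i)) (hds : ∀ i, c⁻¹ (s i) = s (dd i))
    (hfix : ∀ y, (∀ i, y ≠ s i) → c y = y) (hG : Good m cc dd) :
    ∃ (Y : Set Ω) (γ : Ω → Ω), (∀ i, s i ∈ Y) ∧ (∀ y ∈ Y, α y ∈ Y) ∧ (∀ y ∈ Y, β y ∈ Y) ∧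
      ∀ y ∈ Y, γ y ∈ Y ∧ γ (γ y) = y ∧ γ (α y) = α⁻¹ (γ y) ∧ γ (β y) = β⁻¹ (γ y) := by
  classical
  obtain ⟨len, q, A⟩ := Arc.exists α⁻¹ s hs
  set a' : Equiv.Perm Ω := α * c with ha'
  have hfix' : ∀ y, (∀ i, y ≠ s i) → c⁻¹ y = y := by
    intro y hy
    rw [Equiv.Perm.inv_eq_iff_eq, hfix y hy]
  have ha'inv : ∀ y, a'⁻¹ y = c⁻¹ (α⁻¹ y) := by
    intro y; rw [ha', mul_inv_rev]; rfl
  -- the powers of `a'⁻¹` along an arc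
  have hpow : ∀ i p, p < len i → (a'⁻¹ ^ p) (s i) = (α⁻¹ ^ p) (s i) := by
    intro i p
    induction p with
    | zero => intro _; rfl
    | succ p ih =>
      intro hp
      rw [pow_succ', Equiv.Perm.mul_apply, ih (by omega), ha'inv, ← Equiv.Perm.mul_apply α⁻¹,
        ← pow_succ', hfix' _ (A.off i _ (by omega) hp)]
  have A' : Arc a'⁻¹ s len (fun k => dd (q k)) := by
    refine ⟨hs, A.pos, fun i p h0 hp j => ?_, fun i => ?_⟩
    · rw [hpow i p hp]; exact A.off i p h0 hp j
    · have h := A.pos i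
      obtain ⟨n, hn⟩ : ∃ n, len i = n + 1 := ⟨len i - 1, by omega⟩
      rw [hn, pow_succ', Equiv.Perm.mul_apply, hpow i n (by omega), ha'inv,
        ← Equiv.Perm.mul_apply α⁻¹, ← pow_succ', ← hn, A.ret, hds]
  -- the set X
  let X : Set Ω := {y | ∃ i t, t < len i ∧ (α⁻¹ ^ t) (s i) = y}
  have hsX : ∀ i, s i ∈ X := fun i => ⟨i, 0, A.pos i, rfl⟩
  have hX : ∀ y, y ∈ X ↔ ∃ i, α.SameCycle (s i) y := by
    intro y
    constructor
    · rintro ⟨i, t, _, rfl⟩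
      exact ⟨i, Equiv.Perm.sameCycle_inv.1 (sameCycle_of_nat rfl)⟩
    · rintro ⟨i, h⟩
      obtain ⟨n, rfl⟩ := sameCycle_nat (Equiv.Perm.sameCycle_inv.2 h)
      obtain ⟨k, t, ht, e⟩ := A.iter i n
      exact ⟨_, t, ht, e.symm⟩
  have hX' : ∀ y, y ∈ X ↔ ∃ i, a'.SameCycle (s i) y := by
    intro y
    constructor
    · rintro ⟨i, t, ht, rfl⟩
      refine ⟨i, Equiv.Perm.sameCycle_inv.1 (sameCycle_of_nat (hpow i t ht))⟩
    · rintro ⟨i, h⟩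
      obtain ⟨n, rfl⟩ := sameCycle_nat (Equiv.Perm.sameCycle_inv.2 h)
      obtain ⟨k, t, ht, e⟩ := A'.iter i n
      exact ⟨_, t, ht, by rw [e, hpow _ _ ht]⟩
  have hαX : ∀ y, α y ∈ X ↔ y ∈ X := by
    intro y; rw [hX, hX]; simp
  have ha'X : ∀ y, a' y ∈ X ↔ y ∈ X := by
    intro y; rw [hX', hX']; simp
  have hoffX : ∀ y, y ∉ X → a' y = α y := by
    intro y hy
    rw [ha', Equiv.Perm.mul_apply, hfix y]
    rintro i rfl
    exact hy (hsX i)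
  -- second layer arcs
  obtain ⟨k, T, B⟩ := Arc.exists β⁻¹ (Subtype.val : X → Ω) Subtype.val_injective
  have hgα : ∀ y, β⁻¹ (α y) = a' (β⁻¹ y) := by
    intro y
    have := congrArg (fun f : Equiv.Perm Ω => β⁻¹ (f (β⁻¹ y))) hcomm
    simpa using this
  have offB : ∀ (z : X) p, 0 < p → p < k z → (β⁻¹ ^ p) z.1 ∉ X := by
    intro z p h0 hp h
    exact B.off z p h0 hp ⟨_, h⟩ rfl
  have F1 : ∀ (z : X) p, p < k z → (β⁻¹ ^ p) (α z.1) = α ((β⁻¹ ^ p) z.1) := by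
    intro z p
    induction p with
    | zero => intro _; rfl
    | succ p ih =>
      intro hp
      rw [pow_succ', Equiv.Perm.mul_apply, ih (by omega), hgα, ← Equiv.Perm.mul_apply β⁻¹,
        ← pow_succ', hoffX _ (offB z _ (by omega) hp)]
  have F2 : ∀ z : X, (β⁻¹ ^ k z) (α z.1) = a' (T z).1 := by
    intro z
    have h := B.pos z
    obtain ⟨n, hn⟩ : ∃ n, k z = n + 1 := ⟨k z - 1, by omega⟩
    rw [← B.ret z, hn, pow_succ', Equiv.Perm.mul_apply, F1 z n (by omega), hgα,
      ← Equiv.Perm.mul_apply β⁻¹]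
  let aX : X → X := fun z => ⟨α z.1, (hαX _).2 z.2⟩
  let aX' : X → X := fun z => ⟨a' z.1, (ha'X _).2 z.2⟩
  have F3 : ∀ z : X, k (aX z) = k z ∧ T (aX z) = aX' (T z) := by
    intro z
    apply B.len_eq (B.pos z)
    · intro p h0 hp j h
      have h1 : (β⁻¹ ^ p) (α z.1) = j.1 := h
      rw [F1 z p hp] at h1
      exact offB z p h0 hp ((hαX _).1 (h1 ▸ j.2))
    · exact F2 z
  have kn : ∀ (n : ℕ) (z w : X), (α ^ n) z.1 = w.1 → k w = k z ∧ (T w).1 = (a' ^ n) (T z).1 := by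
    intro n
    induction n with
    | zero =>
      intro z w h
      have : z = w := Subtype.ext h
      subst this
      exact ⟨rfl, rfl⟩
    | succ n ih =>
      intro z w h
      have hw : w = aX ⟨(α ^ n) z.1, (hX _).2 (by
          obtain ⟨i, hi⟩ := (hX _).1 z.2
          exact ⟨i, hi.trans (sameCycle_of_nat rfl)⟩)⟩ := by
        apply Subtype.ext
        rw [← h, pow_succ', Equiv.Perm.mul_apply]
      have h1 := ih z ⟨(α ^ n) z.1, (hX _).2 (by
          obtain ⟨i, hi⟩ := (hX _).1 z.2
          exact ⟨i, hi.trans (sameCycle_of_nat rfl)⟩)⟩ rfl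
      rw [hw, (F3 _).1, (F3 _).2, h1.1]
      refine ⟨rfl, ?_⟩
      change a' _ = _
      rw [h1.2, pow_succ']
      rfl
  have Tinj := B.qinj
  have Tsurj : Function.Surjective T := Finite.surjective_of_injective Tinj
  have Tsame : ∀ z w : X, α.SameCycle z.1 w.1 ↔ a'.SameCycle (T z).1 (T w).1 := by
    intro z w
    constructor
    · intro h
      obtain ⟨n, h⟩ := sameCycle_nat h
      exact sameCycle_of_nat (kn n z w h).2.symm
    · intro h
      obtain ⟨n, h⟩ := sameCycle_nat h
      have hv : (α ^ n) z.1 ∈ X := (hX _).2 (by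
          obtain ⟨i, hi⟩ := (hX _).1 z.2
          exact ⟨i, hi.trans (sameCycle_of_nat rfl)⟩)
      have h1 := (kn n z ⟨_, hv⟩ rfl).2
      rw [h] at h1
      have h2 := Tinj (Subtype.ext h1)
      rw [← h2]
      exact sameCycle_of_nat rfl
  have relq : ∀ i j, rel q i j ↔ α.SameCycle (s i) (s j) := by
    intro i j
    rw [← Equiv.Perm.sameCycle_inv, A.sameCycle_iff]
    exact ⟨iterate_of_rel q i j, fun ⟨n, h⟩ => h ▸ rel_of_iterate hm q A.qinj i n⟩
  have relq' : ∀ i j, rel (fun k => dd (q k)) i j ↔ a'.SameCycle (s i) (s j) := by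
    intro i j
    rw [← Equiv.Perm.sameCycle_inv, A'.sameCycle_iff]
    exact ⟨iterate_of_rel _ i j, fun ⟨n, h⟩ => h ▸ rel_of_iterate hm _ A'.qinj i n⟩
  let sX : Fin m → X := fun i => ⟨s i, hsX i⟩
  have hmu : ∀ i, ∃ j, a'.SameCycle (s j) (T (sX i)).1 ∧
      ∀ l, a'.SameCycle (s l) (T (sX i)).1 → j ≤ l := by
    intro i
    have hne : (Finset.univ.filter fun j => a'.SameCycle (s j) (T (sX i)).1).Nonempty := by
      obtain ⟨j, hj⟩ := (hX' _).1 (T (sX i)).2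
      exact ⟨j, by simpa using hj⟩
    refine ⟨Finset.min' _ hne, ?_, fun l hl => Finset.min'_le _ _ (by simpa using hl)⟩
    have := Finset.min'_mem _ hne
    simpa using this
  choose mu hmu1 hmu2 using hmu
  obtain ⟨rho, r1, r2, r3, r4⟩ := hG q mu len A.qinj A.pos
    (by
      intro i j h
      exact hmu2 i j (((relq' _ _).1 h).symm.trans (hmu1 i)))
    (by
      intro i j
      unfold Same
      rw [relq, relq', show s i = (sX i).1 from rfl, show s j = (sX j).1 from rfl, Tsame]
      exact ⟨fun h => ((hmu1 i).trans h).trans (hmu1 j).symm,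
        fun h => ((hmu1 i).symm.trans h).trans (hmu1 j)⟩)
    (by
      intro j
      obtain ⟨z, hz⟩ := Tsurj (sX j)
      obtain ⟨i, hi⟩ := (hX _).1 z.2
      refine ⟨i, ?_⟩
      rw [relq']
      have := (Tsame (sX i) z).1 hi
      rw [hz] at this
      exact (hmu1 i).trans this)
    (by
      intro i
      have e1 := A.card i
      have e2 := A'.card (mu i)
      have e3 : (Finset.univ.filter fun y => (α⁻¹).SameCycle (s i) y).card =
          (Finset.univ.filter fun y => (a'⁻¹).SameCycle (s (mu i)) y).card := by
        have hmem : ∀ y ∈ Finset.univ.filter fun y => (α⁻¹).SameCycle (s i) y, y ∈ X := by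
          intro y hy
          rw [Finset.mem_filter, Equiv.Perm.sameCycle_inv] at hy
          exact (hX y).2 ⟨i, hy.2⟩
        refine Finset.card_bij (fun y hy => (T ⟨y, hmem y hy⟩).1) ?_ ?_ ?_
        · intro y hy
          have hy' := hy
          rw [Finset.mem_filter, Equiv.Perm.sameCycle_inv] at hy'
          rw [Finset.mem_filter, Equiv.Perm.sameCycle_inv]
          exact ⟨Finset.mem_univ _, (hmu1 i).trans ((Tsame (sX i) ⟨y, hmem y hy⟩).1 hy'.2)⟩
        · intro y hy y' hy' h
          exact congrArg Subtype.val (Tinj (Subtype.ext h))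
        · intro w hw
          rw [Finset.mem_filter, Equiv.Perm.sameCycle_inv] at hw
          obtain ⟨z, hz⟩ := Tsurj ⟨w, (hX' _).2 ⟨_, hw.2⟩⟩
          have hz' : α.SameCycle (s i) z.1 := by
            rw [show s i = (sX i).1 from rfl, Tsame, hz]
            exact (hmu1 i).symm.trans hw.2
          refine ⟨z.1, ?_, ?_⟩
          · rw [Finset.mem_filter, Equiv.Perm.sameCycle_inv]
            exact ⟨Finset.mem_univ _, hz'⟩
          · exact congrArg Subtype.val hz
      have f1 : (Finset.univ.filter fun j => rel q i j) =
          Finset.univ.filter fun j => ∃ k, q^[k] i = j := by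
        ext j
        rw [Finset.mem_filter, Finset.mem_filter, relq, ← Equiv.Perm.sameCycle_inv, A.sameCycle_iff]
      have f2 : (Finset.univ.filter fun j => rel (fun k => dd (q k)) (mu i) j) =
          Finset.univ.filter fun j => ∃ k, (fun k => dd (q k))^[k] (mu i) = j := by
        ext j
        rw [Finset.mem_filter, Finset.mem_filter, relq', ← Equiv.Perm.sameCycle_inv,
          A'.sameCycle_iff]
      have e4 : ∀ (D1 : DecidablePred fun y => (α⁻¹).SameCycle (s i) y)
          (D2 : DecidablePred fun y => (a'⁻¹).SameCycle (s (mu i)) y),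
          (@Finset.filter _ _ D1 Finset.univ).card = (@Finset.filter _ _ D2 Finset.univ).card := by
        intro D1 D2
        convert e3
      rw [f1, f2]
      convert (e1.symm.trans (e4 _ _)).trans e2)
  -- the flip on X
  obtain ⟨r, hr⟩ := A.flip rho
  have rX : ∀ y ∈ X, r y ∈ X := by
    rintro y ⟨i, t, ht, rfl⟩
    rw [hr i t ht]
    exact ⟨rho i, _, by rw [r3]; omega, rfl⟩
  have rr : ∀ y ∈ X, r (r y) = y := by
    rintro y ⟨i, t, ht, rfl⟩
    exact Arc.flip_flip hr r1 r3 ht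
  have rb : ∀ y ∈ X, r (α y) = a'⁻¹ (r y) := by
    intro y hy
    obtain ⟨i, t, ht, e⟩ := (hαX y).2 hy
    have := A.flip_rel hr r3 c hfix (fun i => by rw [hcs, r2]) ht
    rw [e, inv_self, Equiv.Perm.inv_eq_iff_eq] at this
    rw [Equiv.Perm.eq_inv_iff_eq, ha', Equiv.Perm.mul_apply, this]
  have ra' : ∀ y ∈ X, r (a' y) = α⁻¹ (r y) := by
    intro y hy
    have hy' := (ha'X y).2 hy
    have h1 := rb (r (a' y)) (rX _ hy')
    rw [rr _ hy', inv_self] at h1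
    have h2 := congrArg r h1
    rw [rr _ ((hαX _).2 (rX _ hy'))] at h2
    rw [Equiv.Perm.eq_inv_iff_eq]
    exact h2
  have ra'n : ∀ (n : ℕ), ∀ y ∈ X, r ((a' ^ n) y) = (α⁻¹ ^ n) (r y) := by
    intro n
    induction n with
    | zero => intro y _; rfl
    | succ n ih =>
      intro y hy
      have hy' : (a' ^ n) y ∈ X := by
        obtain ⟨i, hi⟩ := (hX' _).1 hy
        exact (hX' _).2 ⟨i, hi.trans (sameCycle_of_nat rfl)⟩
      rw [pow_succ', Equiv.Perm.mul_apply, ra' _ hy', ih y hy, pow_succ', Equiv.Perm.mul_apply]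
  let U : X → X := fun z => ⟨r (T z).1, rX _ (T z).2⟩
  have Upow : ∀ (n : ℕ) (z w : X), (α ^ n) z.1 = w.1 → (U w).1 = (α⁻¹ ^ n) (U z).1 := by
    intro n z w h
    change r (T w).1 = _
    rw [(kn n z w h).2, ra'n n _ (T z).2]
  have Us : ∀ i, α.SameCycle (s i) (U (sX i)).1 := by
    intro i
    have h1 : a'.SameCycle (s (rho i)) (T (sX i)).1 :=
      ((relq' _ _).1 (r4 i)).symm.trans (hmu1 i)
    obtain ⟨n, hn⟩ := sameCycle_nat h1
    change α.SameCycle (s i) (r (T (sX i)).1)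
    have h2 : r (s (rho i)) = (α⁻¹ ^ (len (rho i) - 1 - 0)) (s (rho (rho i))) :=
      hr (rho i) 0 (A.pos _)
    rw [← hn, ra'n n _ (hsX _), h2, r1, ← Equiv.Perm.mul_apply, ← pow_add,
      ← Equiv.Perm.sameCycle_inv]
    exact sameCycle_of_nat rfl
  have Usame : ∀ z : X, α.SameCycle z.1 (U z).1 := by
    intro z
    obtain ⟨i, hi⟩ := (hX _).1 z.2
    obtain ⟨n, hn⟩ := sameCycle_nat hi
    have h1 : α.SameCycle (U (sX i)).1 (U z).1 := by
      rw [Upow n (sX i) z hn, ← Equiv.Perm.sameCycle_inv]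
      exact sameCycle_of_nat rfl
    exact (hi.symm.trans (Us i)).trans h1
  have UU : ∀ z : X, U (U z) = z := by
    intro z
    obtain ⟨n, hn⟩ := sameCycle_nat (Usame z)
    apply Subtype.ext
    rw [Upow n z (U z) hn, ← hn]
    simp
  have Uk : ∀ z : X, k (U z) = k z := by
    intro z
    obtain ⟨n, hn⟩ := sameCycle_nat (Usame z)
    exact (kn n z (U z) hn).1
  have Ua : ∀ z : X, (U (aX z)).1 = α⁻¹ (U z).1 := by
    intro z
    have := Upow 1 z (aX z) (by simp [aX])
    simpa using this
  have TUT : ∀ z : X, U z = T (U (T z)) := by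
    intro z
    obtain ⟨w, hw⟩ : ∃ w : X, w = U (T z) := ⟨_, rfl⟩
    have h1 : U w = T z := by rw [hw, UU]
    apply Subtype.ext
    change r (T z).1 = _
    rw [← hw, ← h1]
    exact rr _ (T w).2
  -- the flip for the second layer
  obtain ⟨γ, hγ⟩ := B.flip U
  let Y : Set Ω := {y | ∃ (z : X) (t : ℕ), t < k z ∧ (β⁻¹ ^ t) z.1 = y}
  have hY : ∀ y, y ∈ Y ↔ ∃ z : X, β.SameCycle z.1 y := by
    intro y
    constructor
    · rintro ⟨i, t, _, rfl⟩
      exact ⟨i, Equiv.Perm.sameCycle_inv.1 (sameCycle_of_nat rfl)⟩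
    · rintro ⟨i, h⟩
      obtain ⟨n, rfl⟩ := sameCycle_nat (Equiv.Perm.sameCycle_inv.2 h)
      obtain ⟨k, t, ht, e⟩ := B.iter i n
      exact ⟨_, t, ht, e.symm⟩
  have hβY : ∀ y ∈ Y, β y ∈ Y := by
    intro y hy
    rw [hY] at hy ⊢
    simpa using hy
  refine ⟨Y, γ, fun i => ⟨sX i, 0, B.pos _, rfl⟩, ?_, hβY, ?_⟩
  · rintro y ⟨z, t, ht, rfl⟩
    refine ⟨aX z, t, ?_, F1 z t ht⟩
    rw [(F3 z).1]; exact ht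
  · intro y hy
    refine ⟨?_, ?_, ?_, ?_⟩
    · obtain ⟨z, t, ht, rfl⟩ := hy
      rw [hγ z t ht]
      exact ⟨U z, _, by rw [Uk]; omega, rfl⟩
    · obtain ⟨z, t, ht, rfl⟩ := hy
      exact Arc.flip_flip hγ UU Uk ht
    · obtain ⟨z, t, ht, rfl⟩ := hy
      have hv : α⁻¹ (U z).1 ∈ X := by
        rw [← hαX]; simp
      have hk : k ⟨_, hv⟩ = k (U z) := by
        rw [← (F3 ⟨_, hv⟩).1]
        congr 1
        apply Subtype.ext
        simp [aX]
      have h1 := hγ (aX z) t (by rw [(F3 z).1]; exact ht)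
      rw [← F1 z t ht, hγ z t ht]
      refine h1.trans ?_
      rw [(F3 z).1, Ua]
      have h2 := F1 ⟨_, hv⟩ (k z - 1 - t) (by rw [hk, Uk]; omega)
      rw [Equiv.Perm.eq_inv_iff_eq, ← h2]
      simp
    · obtain ⟨z, t, ht, e⟩ := hβY y hy
      have := B.flip_rel hγ Uk 1 (fun _ _ => rfl)
        (fun i => congrArg Subtype.val (TUT i)) ht
      rw [e, inv_self, Equiv.Perm.one_apply] at this
      exact this.symm

theorem glue {Ω : Type*} [Fintype Ω] (α β : Equiv.Perm Ω) (Y : Set Ω) (γ : Ω → Ω)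
    (hα : ∀ y ∈ Y, α y ∈ Y) (hβ : ∀ y ∈ Y, β y ∈ Y)
    (hγ : ∀ y ∈ Y, γ y ∈ Y ∧ γ (γ y) = y ∧ γ (α y) = α⁻¹ (γ y) ∧ γ (β y) = β⁻¹ (γ y))
    (hc : ∀ y, y ∉ Y → α (β y) = β (α y)) :
    ∃ δ : Equiv.Perm Ω, δ⁻¹ * α * δ = α⁻¹ ∧ δ⁻¹ * β * δ = β⁻¹ := by
  classical
  have inv : ∀ f : Equiv.Perm Ω, (∀ y ∈ Y, f y ∈ Y) → ∀ y, f y ∈ Y ↔ y ∈ Y := by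
    intro f hf y
    refine ⟨fun h => ?_, hf y⟩
    have : ∀ n : ℕ, ∀ w ∈ Y, (f ^ n) w ∈ Y := by
      intro n
      induction n with
      | zero => intro w hw; exact hw
      | succ n ih => intro w hw; rw [pow_succ, Equiv.Perm.mul_apply]; exact ih _ (hf w hw)
    have h2 := this (orderOf f - 1) _ h
    rw [← Equiv.Perm.mul_apply, ← pow_succ, Nat.sub_add_cancel (orderOf_pos f),
      pow_orderOf_eq_one] at h2
    exact h2
  have iα := inv α hα
  have iβ := inv β hβ
  let A0 : Equiv.Perm {y // y ∉ Y} := α.subtypePerm (fun y => not_congr (iα y))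
  let B0 : Equiv.Perm {y // y ∉ Y} := β.subtypePerm (fun y => not_congr (iβ y))
  obtain ⟨g, g1, g2, g3⟩ := comm_inv A0 B0 (by
    apply Equiv.ext
    rintro ⟨y, hy⟩
    apply Subtype.ext
    exact hc y hy)
  let δ : Ω → Ω := fun y => if h : y ∈ Y then γ y else (g ⟨y, h⟩).1
  have d1 : ∀ y ∈ Y, δ y = γ y := fun y h => dif_pos h
  have d2 : ∀ y (h : y ∉ Y), δ y = (g ⟨y, h⟩).1 := fun y h => dif_neg h
  have hinv : Function.Involutive δ := by
    intro y
    by_cases h : y ∈ Y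
    · rw [d1 y h, d1 _ (hγ y h).1, (hγ y h).2.1]
    · rw [d2 y h, d2 _ (g ⟨y, h⟩).2]
      exact congrArg Subtype.val (g1 ⟨y, h⟩)
  have hδα : ∀ y, α (δ (α y)) = δ y := by
    intro y
    by_cases h : y ∈ Y
    · rw [d1 _ (hα y h), d1 y h, (hγ y h).2.2.1, self_inv]
    · rw [d2 y h, d2 _ (mt (iα y).1 h)]
      have := g2 ⟨y, h⟩
      rw [Equiv.Perm.eq_inv_iff_eq] at this
      exact congrArg Subtype.val this
  have hδβ : ∀ y, β (δ (β y)) = δ y := by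
    intro y
    by_cases h : y ∈ Y
    · rw [d1 _ (hβ y h), d1 y h, (hγ y h).2.2.2, self_inv]
    · rw [d2 y h, d2 _ (mt (iβ y).1 h)]
      have := g3 ⟨y, h⟩
      rw [Equiv.Perm.eq_inv_iff_eq] at this
      exact congrArg Subtype.val this
  refine ⟨hinv.toPerm δ, ?_, ?_⟩
  · rw [mul_assoc, inv_mul_eq_iff_eq_mul, eq_mul_inv_iff_mul_eq]
    apply Equiv.ext
    intro y
    exact hδα y
  · rw [mul_assoc, inv_mul_eq_iff_eq_mul, eq_mul_inv_iff_mul_eq]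
    apply Equiv.ext
    intro y
    exact hδβ y

theorem main {Ω : Type*} [Fintype Ω] [DecidableEq Ω] (α β : Equiv.Perm Ω)
    (h : (α⁻¹ * β⁻¹ * α * β).support.card ≤ 4) :
    ∃ δ : Equiv.Perm Ω, δ⁻¹ * α * δ = α⁻¹ ∧ δ⁻¹ * β * δ = β⁻¹ := by
  obtain ⟨c, hc⟩ : ∃ c : Equiv.Perm Ω, c = α⁻¹ * β⁻¹ * α * β := ⟨_, rfl⟩
  rw [← hc] at h
  have hcomm : α * β = β * (α * c) := by rw [hc]; group
  have hsign : Equiv.Perm.sign c = 1 := by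
    rw [hc]
    simp only [Equiv.Perm.sign_mul, Equiv.Perm.sign_inv]
    rcases Int.units_eq_one_or (Equiv.Perm.sign α) with h1 | h1 <;>
    rcases Int.units_eq_one_or (Equiv.Perm.sign β) with h2 | h2 <;> simp [h1, h2]
  let e : {x // x ∈ c.support} ≃ Fin c.support.card := c.support.equivFin
  let c0 : Equiv.Perm {x // x ∈ c.support} :=
    c.subtypePerm (fun x => Equiv.Perm.apply_mem_support)
  let c1 : Equiv.Perm (Fin c.support.card) := e.permCongr c0
  have hs1 : Equiv.Perm.sign c1 = 1 := by
    have h5 := Equiv.Perm.sign_subtypePerm c (p := fun x => x ∈ c.support)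
      (fun x => Equiv.Perm.apply_mem_support) (fun x hx => Equiv.Perm.mem_support.2 hx)
    rw [Equiv.Perm.sign_permCongr]
    convert h5.trans hsign
  have hcs : ∀ i, c (e.symm i).1 = (e.symm (c1 i)).1 := by
    intro i
    simp [c1, Equiv.permCongr_apply, c0]
  have hder : ∀ i, c1 i ≠ i := by
    intro i hi
    have h1 := hcs i
    rw [hi] at h1
    exact Equiv.Perm.mem_support.1 (e.symm i).2 h1
  obtain ⟨Y, γ, h1, h2, h3, h4⟩ := core α β c hcomm h (fun i => (e.symm i).1)
    (fun i j hij => e.symm.injective (Subtype.ext hij)) c1 c1.symm hcs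
    (fun i => by rw [Equiv.Perm.inv_eq_iff_eq, hcs]; simp)
    (fun y hy => by
      by_contra hne
      exact hy (e ⟨y, Equiv.Perm.mem_support.2 hne⟩) (by simp))
    (good_all _ h c1 hder hs1)
  refine glue α β Y γ h2 h3 h4 (fun y hy => ?_)
  have hcy : c y = y := by
    by_contra hne
    have := h1 (e ⟨y, Equiv.Perm.mem_support.2 hne⟩)
    simp only [Equiv.symm_apply_apply] at this
    exact hy this
  have := congrArg (fun f : Equiv.Perm Ω => f y) hcomm
  simpa [hcy] using this

end Neftin

/-- Theorem 4.8 (Neftin's conjecture): if the commutator [α,β] fixes at least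
n - 4 points, then α and β can be simultaneously conjugated to their inverses. -/
theorem stmt_13 {n : ℕ} (α β : Equiv.Perm (Fin n))
    (h : n - 4 ≤ (Finset.univ.filter fun p : Fin n => (α⁻¹ * β⁻¹ * α * β) p = p).card) :
    ∃ γ : Equiv.Perm (Fin n), γ⁻¹ * α * γ = α⁻¹ ∧ γ⁻¹ * β * γ = β⁻¹ := by
  apply Neftin.main
  have h1 := Finset.card_filter_add_card_filter_not (s := (Finset.univ : Finset (Fin n)))
    (fun p : Fin n => (α⁻¹ * β⁻¹ * α * β) p = p)
  have h2 : (α⁻¹ * β⁻¹ * α * β).support =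
      Finset.univ.filter fun p : Fin n => ¬ (α⁻¹ * β⁻¹ * α * β) p = p := by
    ext p
    simp only [Equiv.Perm.mem_support, Finset.mem_filter, Finset.mem_univ, true_and, ne_eq]
  rw [Finset.card_univ, Fintype.card_fin] at h1
  rw [h2]
  omega
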